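/- Fix d ≥ 2. For every n ≥ 1, the map π from Γ_{n+1} to Γ_n deleting the last letter of a word is a d-sheeted normal (Galois) covering of Schreier graphs of the BSV torsion-free group with Galois group ℤ/dℤ. Precisely: (i) π(s(w)) = s(π(w)) for every generator s ∈ {a,a⁻¹,b,b⁻¹} and word w of length n+1; (ii) for each k ∈ ℤ/dℤ the map σ_k sending u·x to u·((x+k) mod d) satisfies s(σ_k(w)) = σ_k(s(w)) for every generator s and every word w of length n+1, so each σ_k is a graph automorphism of Γ_{n+1}; (iii) {σ_0,…,σ_{d−1}} is a cyclic group of order d under composition satisfying π∘σ_k = π and acting simply transitively on each fiber π⁻¹(u) = {u·0,…,u·(d−1)}. -/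

import Mathlib

/-- The generator `a` of the BSV torsion-free group on the alphabet `{0,…,d-1}`:
`a(xw)=(x+1)·w` for `x < d-1` and `a((d-1)w)=0·a(w)`. -/
def bsvA (d : ℕ) [NeZero d] : List (Fin d) → List (Fin d)
  | [] => []
  | x :: w => if (x : ℕ) = d - 1 then (x + 1) :: bsvA d w else (x + 1) :: w

/-- The inverse generator `a⁻¹`: `a⁻¹(xw)=(x-1)·w` for `x > 0` and `a⁻¹(0w)=(d-1)·a⁻¹(w)`. -/
def bsvAinv (d : ℕ) [NeZero d] : List (Fin d) → List (Fin d)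
  | [] => []
  | x :: w => if (x : ℕ) = 0 then (x - 1) :: bsvAinv d w else (x - 1) :: w

mutual
/-- The generator `b`: `b(xw)=(x+1)·w` for `x < d-1` and `b((d-1)w)=0·b⁻¹(w)`. -/
def bsvB (d : ℕ) [NeZero d] : List (Fin d) → List (Fin d)
  | [] => []
  | x :: w => if (x : ℕ) = d - 1 then (x + 1) :: bsvBinv d w else (x + 1) :: w
/-- The inverse generator `b⁻¹`: `b⁻¹(xw)=(x-1)·w` for `x > 0` and `b⁻¹(0w)=(d-1)·b(w)`. -/
def bsvBinv (d : ℕ) [NeZero d] : List (Fin d) → List (Fin d)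
  | [] => []
  | x :: w => if (x : ℕ) = 0 then (x - 1) :: bsvB d w else (x - 1) :: w
end

/-- The map `σ_k`, sending `u·x` to `u·(x+k)` (addition mod `d`). -/
def shiftLast (d : ℕ) [NeZero d] (k : Fin d) (w : List (Fin d)) : List (Fin d) :=
  w.dropLast ++ [w.getLastD 0 + k]

/-- A map on words translates last letters if, for every word `u`, it acts on the words `u·x`
by adding to `x` a constant depending only on `u`. -/
def TranslatesLast (d : ℕ) (s : List (Fin d) → List (Fin d)) : Prop :=
  ∀ u : List (Fin d), ∃ c : Fin d, ∀ x : Fin d, s (u ++ [x]) = s u ++ [x + c]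

theorem translatesLast_bsvA (d : ℕ) [NeZero d] : TranslatesLast d (bsvA d) := by
  intro u
  induction u with
  | nil => exact ⟨1, fun x => by simp [bsvA]⟩
  | cons y u ih =>
    obtain ⟨c, hc⟩ := ih
    by_cases hy : (y : ℕ) = d - 1
    · exact ⟨c, fun x => by simp [bsvA, hy, hc]⟩
    · exact ⟨0, fun x => by simp [bsvA, hy]⟩

theorem translatesLast_bsvAinv (d : ℕ) [NeZero d] : TranslatesLast d (bsvAinv d) := by
  intro u
  induction u with
  | nil => exact ⟨-1, fun x => by simp [bsvAinv, sub_eq_add_neg]⟩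
  | cons y u ih =>
    obtain ⟨c, hc⟩ := ih
    by_cases hy : (y : ℕ) = 0
    · exact ⟨c, fun x => by simp [bsvAinv, hy, hc]⟩
    · exact ⟨0, fun x => by simp [bsvAinv, hy]⟩

theorem translatesLast_bsvB_and_bsvBinv (d : ℕ) [NeZero d] :
    TranslatesLast d (bsvB d) ∧ TranslatesLast d (bsvBinv d) := by
  refine forall_and.mp fun u => ?_
  induction u with
  | nil =>
    exact ⟨⟨1, fun x => by simp [bsvB, bsvBinv]⟩,
      ⟨-1, fun x => by simp [bsvB, bsvBinv, sub_eq_add_neg]⟩⟩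
  | cons y u ih =>
    obtain ⟨⟨c, hc⟩, ⟨e, he⟩⟩ := ih
    constructor
    · by_cases hy : (y : ℕ) = d - 1
      · exact ⟨e, fun x => by simp [bsvB, hy, he]⟩
      · exact ⟨0, fun x => by simp [bsvB, hy]⟩
    · by_cases hy : (y : ℕ) = 0
      · exact ⟨c, fun x => by simp [bsvBinv, hy, hc]⟩
      · exact ⟨0, fun x => by simp [bsvBinv, hy]⟩

theorem translatesLast_of_mem_generators (d : ℕ) [NeZero d] {s : List (Fin d) → List (Fin d)}
    (hs : s ∈ [bsvA d, bsvAinv d, bsvB d, bsvBinv d]) : TranslatesLast d s := by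
  simp only [List.mem_cons, List.not_mem_nil, or_false] at hs
  rcases hs with rfl | rfl | rfl | rfl
  · exact translatesLast_bsvA d
  · exact translatesLast_bsvAinv d
  · exact (translatesLast_bsvB_and_bsvBinv d).1
  · exact (translatesLast_bsvB_and_bsvBinv d).2

theorem shiftLast_append_singleton (d : ℕ) [NeZero d] (k : Fin d) (u : List (Fin d))
    (x : Fin d) : shiftLast d k (u ++ [x]) = u ++ [x + k] := by
  simp [shiftLast]

theorem exists_eq_append_singleton {α : Type*} {w : List α} {n : ℕ}
    (hw : w.length = n + 1) : ∃ u x, w = u ++ [x] := by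
  have hne : w ≠ [] := List.ne_nil_of_length_eq_add_one hw
  exact ⟨w.dropLast, w.getLast hne, (List.dropLast_append_getLast hne).symm⟩

/-- For `d ≥ 2` and every `n ≥ 1`, deleting the last letter is a `d`-sheeted normal
(Galois) covering `Γ_{n+1} → Γ_n` of Schreier graphs of the BSV torsion-free group,
with Galois group `ℤ/dℤ = {σ_0,…,σ_{d-1}}` acting simply transitively on the fibers. -/
theorem bsv_galois_covering (d : ℕ) [NeZero d] (hd : 2 ≤ d) (n : ℕ) (hn : 1 ≤ n) :
    (∀ s ∈ [bsvA d, bsvAinv d, bsvB d, bsvBinv d], ∀ w : List (Fin d), w.length = n + 1 →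
        (s w).dropLast = s w.dropLast) ∧
    (∀ k : Fin d, ∀ s ∈ [bsvA d, bsvAinv d, bsvB d, bsvBinv d],
        ∀ w : List (Fin d), w.length = n + 1 →
        s (shiftLast d k w) = shiftLast d k (s w)) ∧
    (∀ w : List (Fin d), w.length = n + 1 → shiftLast d 0 w = w) ∧
    (∀ j k : Fin d, ∀ w : List (Fin d), w.length = n + 1 →
        shiftLast d j (shiftLast d k w) = shiftLast d (j + k) w) ∧
    (∀ k : Fin d, k ≠ 0 → ∀ w : List (Fin d), w.length = n + 1 → shiftLast d k w ≠ w) ∧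
    (∀ k : Fin d, ∀ w : List (Fin d), w.length = n + 1 →
        (shiftLast d k w).dropLast = w.dropLast) ∧
    (∀ u : List (Fin d), u.length = n → ∀ w : List (Fin d),
        (w.length = n + 1 ∧ w.dropLast = u) ↔ ∃ x : Fin d, w = u ++ [x]) ∧
    (∀ w w' : List (Fin d), w.length = n + 1 → w'.length = n + 1 →
        w.dropLast = w'.dropLast → ∃! k : Fin d, shiftLast d k w = w') := by
  refine ⟨fun s hs w hw => ?_, fun k s hs w hw => ?_, fun w hw => ?_, fun j k w hw => ?_,
    fun k hk w hw => ?_, fun k w hw => ?_, fun u hu w => ⟨?_, ?_⟩, fun w w' hw hw' h => ?_⟩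
  · obtain ⟨u, x, rfl⟩ := exists_eq_append_singleton hw
    obtain ⟨c, hc⟩ := translatesLast_of_mem_generators d hs u
    simp [hc]
  · obtain ⟨u, x, rfl⟩ := exists_eq_append_singleton hw
    obtain ⟨c, hc⟩ := translatesLast_of_mem_generators d hs u
    simp only [hc, shiftLast_append_singleton, add_right_comm]
  · obtain ⟨u, x, rfl⟩ := exists_eq_append_singleton hw
    simp [shiftLast_append_singleton]
  · obtain ⟨u, x, rfl⟩ := exists_eq_append_singleton hw
    simp only [shiftLast_append_singleton, add_assoc, add_comm j k]
  · obtain ⟨u, x, rfl⟩ := exists_eq_append_singleton hw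
    simpa [shiftLast_append_singleton] using hk
  · obtain ⟨u, x, rfl⟩ := exists_eq_append_singleton hw
    simp [shiftLast_append_singleton]
  · rintro ⟨hw, rfl⟩
    obtain ⟨v, x, rfl⟩ := exists_eq_append_singleton hw
    exact ⟨x, by simp⟩
  · rintro ⟨x, rfl⟩
    simp [hu]
  · obtain ⟨u, x, rfl⟩ := exists_eq_append_singleton hw
    obtain ⟨v, y, rfl⟩ := exists_eq_append_singleton hw'
    obtain rfl : u = v := by simpa using h
    refine ⟨y - x, by simp [shiftLast_append_singleton], fun k hk => ?_⟩
    have hxy : x + k = y := by simpa [shiftLast_append_singleton] using hk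
    exact eq_sub_of_add_eq' hxy
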